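/- For all integers m, n, t > 0 and all integers a, b ≥ 0 with a + b ≤ n−t, the number of small (m,t)-Schröder paths S of height n with ret(S) = b and dg(S) = n−t−a−b satisfies n · #{S ∈ S(m,n,t) : ret(S) = b and dg(S) = n−t−a−b} = (t+b)·C(mn+a−1, a)·C(mn, n−t−a−b), as an identity of integers. -/

import Mathlib

/-- A step of a lattice path: north `(0,1)`, east `(1,0)` or diagonal `(1,1)`. -/
inductive Step : Type
  | N : Step
  | E : Step
  | D : Step
  deriving DecidableEq

/-- The displacement vector of a step. -/
def stepVec : Step → ℤ × ℤ
  | .N => (0, 1)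
  | .E => (1, 0)
  | .D => (1, 1)

/-- The lattice point reached after the first `k` steps of the path `P` (starting at the
origin). -/
def pt (P : List Step) (k : ℕ) : ℤ × ℤ := ((P.take k).map stepVec).sum

/-- The path `P` starts with at least `t` north steps. -/
def StartsNorth (t : ℤ) (P : List Step) : Prop := List.replicate t.toNat Step.N <+: P

/-- The path `P` stays weakly above the line `x = m·y`. -/
def AboveLine (m : ℤ) (P : List Step) : Prop := ∀ k : ℕ, (pt P k).1 ≤ m * (pt P k).2

/-- An `(m,t)`-Schröder path of height `n`: a lattice path from `(0,0)` to `(mn,n)` using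
north, east and diagonal steps, starting with at least `t` north steps and never going
below the line `x = m·y`. -/
def IsSchroeder (m n t : ℤ) (P : List Step) : Prop :=
  StartsNorth t P ∧ pt P P.length = (m * n, n) ∧ AboveLine m P

/-- An `(m,t)`-Dyck path of height `n`: an `(m,t)`-Schröder path of height `n` with no
diagonal steps. -/
def IsDyck (m n t : ℤ) (P : List Step) : Prop :=
  IsSchroeder m n t P ∧ ∀ s ∈ P, s ≠ Step.D

/-- A Schröder path is small if none of its diagonal steps starts on the line `x = m·y`. -/
def IsSmall (m : ℤ) (P : List Step) : Prop :=
  ∀ j : ℕ, P[j]? = some Step.D → (pt P j).1 ≠ m * (pt P j).2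

/-- A Schröder path is positive if it touches the line `x = m·y` only at its two
endpoints. -/
def IsPositive (m : ℤ) (P : List Step) : Prop :=
  ∀ k : ℕ, 0 < k → k < P.length → (pt P k).1 ≠ m * (pt P k).2

/-- The set of indices `j` such that the `j`-th step of `P` is east and the `(j+1)`-st is
north; the corresponding valley point is `pt P (j+1)`. -/
def valleys (P : List Step) : Finset ℕ :=
  (Finset.range P.length).filter fun j => P[j]? = some Step.E ∧ P[j + 1]? = some Step.N

/-- The number of valleys of `P`. -/
def val (P : List Step) : ℕ := (valleys P).card

/-- The number of valleys of `P` whose `x`-coordinate is congruent to `i` modulo `m`. -/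
def ival (m i : ℤ) (P : List Step) : ℕ :=
  ((valleys P).filter fun j => (pt P (j + 1)).1 % m = i % m).card

/-- The set of returns of `P`: valleys of the form `(m·i, i)`. -/
def returns (m : ℤ) (P : List Step) : Finset ℕ :=
  (valleys P).filter fun j => (pt P (j + 1)).1 = m * (pt P (j + 1)).2

/-- The number of returns of `P`. -/
def ret (m : ℤ) (P : List Step) : ℕ := (returns m P).card

/-- The set of indices of diagonal steps of `P`. -/
def diags (P : List Step) : Finset ℕ :=
  (Finset.range P.length).filter fun j => P[j]? = some Step.D

/-- The number of diagonal steps of `P`. -/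
def dg (P : List Step) : ℕ := (diags P).card

/-- A Schröder path is `m`-divisible if every diagonal step ends at an `x`-coordinate
divisible by `m`. -/
def MDivisible (m : ℤ) (P : List Step) : Prop :=
  ∀ j ∈ diags P, m ∣ (pt P (j + 1)).1

/-- The number of cornered diagonal steps of `P`: diagonal steps connecting `(i·m − 1, i)`
to `(i·m, i + 1)` for some `i`. -/
def cd (m : ℤ) (P : List Step) : ℕ :=
  ((diags P).filter fun j => (pt P (j + 1)).1 = m * ((pt P (j + 1)).2 - 1)).card

/-- The generalized binomial coefficient `C(p,q) = p(p−1)⋯(p−q+1)/q!` for integers `p` and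
`q ≥ 0`, and `C(p,q) = 0` for `q < 0`. -/
def C (p q : ℤ) : ℤ :=
  if q < 0 then 0
  else if 0 ≤ p then (p.toNat.choose q.toNat : ℤ)
  else (-1) ^ q.toNat * ((q - p - 1).toNat.choose q.toNat : ℤ)

/-- `Excursion M h b a d w`: the word `w`, started at height `h` above the line `x = (M+1)·y`
(a north step raises the height by `M + 1`, an east step lowers it by `1`, a diagonal step raises
it by `M`), stays weakly above the line and ends on it, has no diagonal step starting on the line,
`b` north steps starting on the line, `a` other north steps and `d` diagonal steps. -/
inductive Excursion (M : ℕ) : ℕ → ℕ → ℕ → ℕ → List Step → Prop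
  | nil : Excursion M 0 0 0 0 []
  | ret {b a d w} : Excursion M (M + 1) b a d w → Excursion M 0 (b + 1) a d (Step.N :: w)
  | north {h b a d w} : Excursion M (h + 1 + (M + 1)) b a d w →
      Excursion M (h + 1) b (a + 1) d (Step.N :: w)
  | east {h b a d w} : Excursion M h b a d w → Excursion M (h + 1) b a d (Step.E :: w)
  | diag {h b a d w} : Excursion M (h + 1 + M) b a d w →
      Excursion M (h + 1) b a (d + 1) (Step.D :: w)

namespace Excursion

variable {M h b a d : ℕ} {w : List Step}

theorem nil_iff : Excursion M h b a d [] ↔ h = 0 ∧ b = 0 ∧ a = 0 ∧ d = 0 := by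
  constructor
  · rintro ⟨⟩; simp
  · rintro ⟨rfl, rfl, rfl, rfl⟩; exact .nil

theorem zero_iff : Excursion M 0 b a d w ↔ (w = [] ∧ b = 0 ∧ a = 0 ∧ d = 0) ∨
    ∃ b' w', b = b' + 1 ∧ w = Step.N :: w' ∧ Excursion M (M + 1) b' a d w' := by
  constructor
  · intro hw
    cases hw with
    | nil => simp
    | ret hw => exact .inr ⟨_, _, rfl, rfl, hw⟩
  · rintro (⟨rfl, rfl, rfl, rfl⟩ | ⟨b', w', rfl, rfl, hw⟩)
    · exact .nil
    · exact .ret hw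

theorem succ_iff : Excursion M (h + 1) b a d w ↔
    (∃ w', w = Step.E :: w' ∧ Excursion M h b a d w') ∨
    (∃ a' w', a = a' + 1 ∧ w = Step.N :: w' ∧ Excursion M (h + 1 + (M + 1)) b a' d w') ∨
    ∃ d' w', d = d' + 1 ∧ w = Step.D :: w' ∧ Excursion M (h + 1 + M) b a d' w' := by
  constructor
  · intro hw
    cases hw with
    | north hw => exact .inr (.inl ⟨_, _, rfl, rfl, hw⟩)
    | east hw => exact .inl ⟨_, rfl, hw⟩
    | diag hw => exact .inr (.inr ⟨_, _, rfl, rfl, hw⟩)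
  · rintro (⟨w', rfl, hw⟩ | ⟨a', w', rfl, rfl, hw⟩ | ⟨d', w', rfl, rfl, hw⟩)
    · exact .east hw
    · exact .north hw
    · exact .diag hw

theorem replicate_append_iff {k : ℕ} :
    Excursion M (h + 1) b (a + k) d (List.replicate k Step.N ++ w) ↔
      Excursion M (h + 1 + (M + 1) * k) b a d w := by
  induction k generalizing h with
  | zero => simp
  | succ k ih =>
    have key : Excursion M (h + 1) b (a + k + 1) d
        (Step.N :: (List.replicate k Step.N ++ w)) ↔
        Excursion M (h + M + 1 + 1) b (a + k) d (List.replicate k Step.N ++ w) := by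
      rw [show h + M + 1 + 1 = h + 1 + (M + 1) by ring]
      constructor
      · rintro ⟨⟩; assumption
      · exact .north
    rw [List.replicate_succ, List.cons_append, ← add_assoc, key, ih]
    rw [show h + M + 1 + 1 + (M + 1) * k = h + 1 + (M + 1) * (k + 1) by ring]

theorem zero_replicate_append_iff {k : ℕ} :
    Excursion M 0 (b + 1) (a + k) d (List.replicate (k + 1) Step.N ++ w) ↔
      Excursion M ((M + 1) * (k + 1)) b a d w := by
  have key : Excursion M 0 (b + 1) (a + k) d
      (Step.N :: (List.replicate k Step.N ++ w)) ↔
      Excursion M (M + 1) b (a + k) d (List.replicate k Step.N ++ w) := by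
    constructor
    · rintro ⟨⟩; assumption
    · exact .ret
  rw [List.replicate_succ, List.cons_append, key, replicate_append_iff]
  rw [show M + 1 + (M + 1) * k = (M + 1) * (k + 1) by ring]

open Nat in
theorem exists_finset_card (M : ℕ) (l : ℕ) : ∀ h b a d : ℕ,
    h + (M + 1) * b + (M + 2) * a + (M + 1) * d + b = l →
    ∃ s : Finset (List Step), (∀ w, w ∈ s ↔ Excursion M h b a d w) ∧
      (h + (M + 1) * b = 0 ∧ a = 0 ∧ d = 0 → s.card = 1) ∧
      (¬ (h + (M + 1) * b = 0 ∧ a = 0 ∧ d = 0) →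
        s.card * (a ! * d ! * (h + (M + 1) * b + (M + 1) * a + M * d)!) =
          (h + (M + 1) * b) * (h + (M + 1) * b + (M + 2) * a + (M + 1) * d - 1)!) := by
  induction l using Nat.strong_induction_on with
  | _ l ih =>
  intro h b a d hl
  rcases h with _ | h
  · rcases b with _ | b
    · by_cases had : a = 0 ∧ d = 0
      · obtain ⟨rfl, rfl⟩ := had
        refine ⟨{[]}, fun w => ?_, by simp, by simp⟩
        simp [zero_iff]
      · refine ⟨∅, fun w => ?_, by simp [had], by simp⟩
        simp [zero_iff, had]
    · obtain ⟨s, hs, -, hc⟩ := ih (l - 1) (by omega) (M + 1) b a d (by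
        rw [← hl]; ring_nf; omega)
      refine ⟨s.image (List.cons Step.N), fun w => ?_, fun h0 => ?_, fun _ => ?_⟩
      · simp only [Finset.mem_image, hs, zero_iff]
        constructor
        · rintro ⟨w', hw, rfl⟩
          exact .inr ⟨b, w', rfl, rfl, hw⟩
        · rintro (⟨-, h0, -⟩ | ⟨b', w', hb, rfl, hw⟩)
          · omega
          · obtain rfl : b = b' := by omega
            exact ⟨w', hw, rfl⟩
      · exact absurd h0.1 (by positivity)
      · rw [Finset.card_image_of_injective _ (List.cons_injective)]
        have := hc (fun h0 => absurd h0.1 (by positivity))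
        rw [show 0 + (M + 1) * (b + 1) = M + 1 + (M + 1) * b by ring]
        exact this
  · set H := h + (M + 1) * b with hH
    set e := h + (M + 1) * b + (M + 1) * a + M * d with he
    obtain ⟨sE, hsE, hE1, hE2⟩ := ih (l - 1) (by omega) h b a d (by omega)
    obtain ⟨sN, hsN, hcN⟩ : ∃ s : Finset (List Step),
        (∀ w, w ∈ s ↔ ∃ a', a = a' + 1 ∧ Excursion M (h + 1 + (M + 1)) b a' d w) ∧
        s.card * (a ! * d ! * (e + 1)!) = a * (H + 1 + (M + 1)) * (e + a + d - 1)! := by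
      rcases a with _ | a
      · exact ⟨∅, by simp, by simp⟩
      · obtain ⟨s, hs, -, hc⟩ := ih (l - 1) (by omega) (h + 1 + (M + 1)) b a d (by
          rw [← hl]; ring_nf; omega)
        refine ⟨s, fun w => ?_, ?_⟩
        · rw [hs]
          constructor
          · exact fun hw => ⟨a, rfl, hw⟩
          · rintro ⟨a', ha, hw⟩
            obtain rfl : a = a' := by omega
            exact hw
        · have := hc (fun h0 => absurd h0.1 (by positivity))
          rw [show h + 1 + (M + 1) + (M + 1) * b = H + 1 + (M + 1) by rw [hH]; ring,
            show H + 1 + (M + 1) + (M + 1) * a + M * d = e + 1 by rw [he, hH]; ring,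
            show H + 1 + (M + 1) + (M + 2) * a + (M + 1) * d - 1 = e + (a + 1) + d - 1 by
              rw [he, hH]; ring_nf] at this
          rw [Nat.factorial_succ a]
          linear_combination (a + 1) * this
    obtain ⟨sD, hsD, hcD⟩ : ∃ s : Finset (List Step),
        (∀ w, w ∈ s ↔ ∃ d', d = d' + 1 ∧ Excursion M (h + 1 + M) b a d' w) ∧
        s.card * (a ! * d ! * (e + 1)!) = d * (H + 1 + M) * (e + a + d - 1)! := by
      rcases d with _ | d
      · exact ⟨∅, by simp, by simp⟩
      · obtain ⟨s, hs, -, hc⟩ := ih (l - 1) (by omega) (h + 1 + M) b a d (by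
          rw [← hl]; ring_nf; omega)
        refine ⟨s, fun w => ?_, ?_⟩
        · rw [hs]
          constructor
          · exact fun hw => ⟨d, rfl, hw⟩
          · rintro ⟨d', hd, hw⟩
            obtain rfl : d = d' := by omega
            exact hw
        · have := hc (fun h0 => absurd h0.1 (by positivity))
          rw [show h + 1 + M + (M + 1) * b = H + 1 + M by rw [hH]; ring,
            show H + 1 + M + (M + 1) * a + M * d = e + 1 by rw [he, hH]; ring,
            show H + 1 + M + (M + 2) * a + (M + 1) * d - 1 = e + a + (d + 1) - 1 by
              rw [he, hH]; ring_nf] at this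
          rw [Nat.factorial_succ d]
          linear_combination (d + 1) * this
    have hdEN : Disjoint (sE.image (List.cons Step.E)) (sN.image (List.cons Step.N)) := by
      simp [Finset.disjoint_left]
    have hdD : Disjoint (sE.image (List.cons Step.E) ∪ sN.image (List.cons Step.N))
        (sD.image (List.cons Step.D)) := by
      simp only [Finset.disjoint_left, Finset.mem_union, Finset.mem_image]
      rintro w (⟨w', -, rfl⟩ | ⟨w', -, rfl⟩) <;> simp
    refine ⟨sE.image (List.cons Step.E) ∪ sN.image (List.cons Step.N) ∪
      sD.image (List.cons Step.D), fun w => ?_, fun h0 => by omega, fun _ => ?_⟩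
    · simp only [Finset.mem_union, Finset.mem_image, hsE, hsN, hsD, succ_iff]
      grind
    · rw [Finset.card_union_of_disjoint hdD, Finset.card_union_of_disjoint hdEN]
      simp only [Finset.card_image_of_injective _ List.cons_injective]
      rw [show h + 1 + (M + 1) * b = H + 1 by omega,
        show H + 1 + (M + 1) * a + M * d = e + 1 by omega,
        show H + 1 + (M + 2) * a + (M + 1) * d - 1 = e + a + d by
          rw [he, hH]; ring_nf; omega]
      by_cases h0 : H = 0 ∧ a = 0 ∧ d = 0
      · have hE := hE1 h0
        obtain ⟨hH0, rfl, rfl⟩ := h0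
        have he0 : e = 0 := by omega
        simp only [he0, hH0] at hcN hcD ⊢
        simp only [hE]
        simp at hcN hcD ⊢
        simp [hcN, hcD]
      · have hE := hE2 h0
        have hpos : e + a + d = (e + a + d - 1) + 1 := by omega
        rw [show H + (M + 2) * a + (M + 1) * d - 1 = e + a + d - 1 by
          rw [he, hH]; ring_nf] at hE
        have hfac : (e + a + d)! = (e + a + d) * (e + a + d - 1)! := by
          rw [hpos, Nat.factorial_succ]; simp
        have hE' : sE.card * (a ! * d ! * (e + 1)!) = (e + 1) * H * (e + a + d - 1)! := by
          rw [Nat.factorial_succ e]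
          linear_combination (e + 1) * hE
        rw [hfac, add_mul, add_mul, hE', hcN, hcD]
        have : e = H + (M + 1) * a + M * d := rfl
        generalize (e + a + d - 1)! = F
        rw [this]
        ring

end Excursion

/-- The height of the point reached after `k` steps of `P` above the line `x = m·y`. -/
def height (m : ℤ) (P : List Step) (k : ℕ) : ℤ := m * (pt P k).2 - (pt P k).1

/-- The number of north steps of `P` that start on the line `x = m·y`, when `P` itself starts at
height `h` above that line. -/
def groundNorths (m h : ℤ) (P : List Step) : ℕ :=
  ((Finset.range P.length).filter fun j => P[j]? = some Step.N ∧ h + height m P j = 0).card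

theorem pt_zero (P : List Step) : pt P 0 = 0 := by simp [pt]

theorem pt_cons_succ (s : Step) (P : List Step) (k : ℕ) :
    pt (s :: P) (k + 1) = stepVec s + pt P k := by simp [pt]

theorem height_zero (m : ℤ) (P : List Step) : height m P 0 = 0 := by simp [height, pt_zero]

theorem height_cons_succ (m : ℤ) (s : Step) (P : List Step) (k : ℕ) :
    height m (s :: P) (k + 1) = (m * (stepVec s).2 - (stepVec s).1) + height m P k := by
  simp only [height, pt_cons_succ, Prod.fst_add, Prod.snd_add]; ring

theorem card_filter_range_succ (p : ℕ → Prop) [DecidablePred p] (n : ℕ) :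
    ((Finset.range (n + 1)).filter p).card =
      ((Finset.range n).filter fun j => p (j + 1)).card + if p 0 then 1 else 0 := by
  simp only [Finset.card_filter, Finset.sum_range_succ']

theorem groundNorths_cons (m h : ℤ) (s : Step) (P : List Step) :
    groundNorths m h (s :: P) =
      groundNorths m (h + (m * (stepVec s).2 - (stepVec s).1)) P +
        if s = Step.N ∧ h = 0 then 1 else 0 := by
  simp only [groundNorths, List.length_cons, card_filter_range_succ, List.getElem?_cons_succ,
    List.getElem?_cons_zero, height_cons_succ, height_zero, Option.some.injEq, add_zero, add_assoc]

theorem dg_cons (s : Step) (P : List Step) :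
    dg (s :: P) = dg P + if s = Step.D then 1 else 0 := by
  simp only [dg, diags, List.length_cons, card_filter_range_succ, List.getElem?_cons_succ,
    List.getElem?_cons_zero, Option.some.injEq]

theorem groundNorths_add_dg_le (m h : ℤ) (P : List Step) :
    (groundNorths m h P : ℤ) + dg P ≤ (pt P P.length).2 := by
  induction P generalizing h with
  | nil => simp [groundNorths, dg, diags, pt]
  | cons s P ih =>
    have := ih (h + (m * (stepVec s).2 - (stepVec s).1))
    rw [groundNorths_cons, dg_cons, List.length_cons, pt_cons_succ, Prod.snd_add]
    cases s <;> simp [stepVec] at this ⊢ <;> grind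

theorem forall_nat_iff_zero_and_succ {p : ℕ → Prop} : (∀ k, p k) ↔ p 0 ∧ ∀ k, p (k + 1) :=
  ⟨fun h => ⟨h 0, fun k => h (k + 1)⟩, fun h k => k.casesOn h.1 h.2⟩

theorem excursion_iff {M h b a d : ℕ} {w : List Step} :
    Excursion M h b a d w ↔
      (∀ k, 0 ≤ h + height (M + 1) w k) ∧ h + height (M + 1) w w.length = 0 ∧
      (∀ j, w[j]? = some Step.D → h + height (M + 1) w j ≠ 0) ∧
      groundNorths (M + 1) h w = b ∧ dg w = d ∧ (pt w w.length).2 = a + b + d := by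
  induction w generalizing h b a d with
  | nil =>
    simp [Excursion.nil_iff, height, pt, groundNorths, dg, diags]
    omega
  | cons s w ih =>
    rw [forall_nat_iff_zero_and_succ,
      forall_nat_iff_zero_and_succ (p := fun j => (s :: w)[j]? = some Step.D → _)]
    simp only [List.length_cons, height_cons_succ, height_zero, List.getElem?_cons_succ,
      List.getElem?_cons_zero, Option.some.injEq, groundNorths_cons, dg_cons, pt_cons_succ,
      Prod.snd_add, ← add_assoc, add_zero]
    rcases h with _ | h
    · cases s
      · have e : ((0 : ℕ) : ℤ) + (((M : ℤ) + 1) * (stepVec .N).2 - (stepVec .N).1)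
            = ((M + 1 : ℕ) : ℤ) := by simp [stepVec]
        rw [e]
        simp [Excursion.zero_iff, -Nat.cast_add]
        simp only [ih, stepVec]
        grind
      · have hneg := fun x : ∀ k, 0 ≤ ((0 : ℕ) : ℤ) + (((M : ℤ) + 1) * (stepVec .E).2 -
          (stepVec .E).1) + height (M + 1) w k => x 0
        simp only [stepVec, height_zero] at hneg
        simp [Excursion.zero_iff, stepVec]
        grind
      · simp [Excursion.zero_iff]
    · cases s
      · have e : ((h + 1 : ℕ) : ℤ) + (((M : ℤ) + 1) * (stepVec .N).2 - (stepVec .N).1)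
            = ((h + 1 + (M + 1) : ℕ) : ℤ) := by simp [stepVec]
        rw [e]
        have hle := groundNorths_add_dg_le (M + 1) ((h + 1 + (M + 1) : ℕ) : ℤ) w
        rcases a with _ | a
        all_goals
          simp [Excursion.succ_iff, -Nat.cast_add]
          try simp only [ih, stepVec]
          grind
      · have e : ((h + 1 : ℕ) : ℤ) + (((M : ℤ) + 1) * (stepVec .E).2 - (stepVec .E).1)
            = (h : ℤ) := by simp [stepVec]
        rw [e]
        simp [Excursion.succ_iff, -Nat.cast_add]
        simp only [ih, stepVec]
        grind
      · have e : ((h + 1 : ℕ) : ℤ) + (((M : ℤ) + 1) * (stepVec .D).2 - (stepVec .D).1)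
            = ((h + 1 + M : ℕ) : ℤ) := by simp [stepVec]
        rw [e]
        simp [Excursion.succ_iff, -Nat.cast_add]
        simp only [ih, stepVec]
        grind

theorem height_succ {m : ℤ} {P : List Step} {k : ℕ} {s : Step} (hs : P[k]? = some s) :
    height m P (k + 1) = height m P k + (m * (stepVec s).2 - (stepVec s).1) := by
  simp only [height, pt, List.take_add_one, hs, List.map_append, List.sum_append]
  simp
  ring

theorem ret_add_one_eq_groundNorths {m : ℤ} (hm : 0 < m) {P : List Step}
    (hP : P[0]? = some Step.N) (hnn : ∀ k, 0 ≤ height m P k)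
    (hsmall : ∀ j, P[j]? = some Step.D → height m P j ≠ 0) :
    ret m P + 1 = groundNorths m 0 P := by
  have hlast : groundNorths m 0 P = ((Finset.range (P.length + 1)).filter
      fun j => P[j]? = some Step.N ∧ height m P j = 0).card := by
    simp only [groundNorths, zero_add, Finset.range_add_one, Finset.filter_insert]
    simp
  rw [hlast, card_filter_range_succ, if_pos ⟨hP, height_zero m P⟩, ret, returns, valleys,
    Finset.filter_filter]
  congr 2
  refine Finset.filter_congr fun j hj => ?_
  have hline : (pt P (j + 1)).1 = m * (pt P (j + 1)).2 ↔ height m P (j + 1) = 0 := by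
    rw [height, sub_eq_zero, eq_comm]
  rw [hline]
  refine ⟨fun ⟨⟨_, hN⟩, h0⟩ => ⟨hN, h0⟩, fun ⟨hN, h0⟩ => ⟨⟨?_, hN⟩, h0⟩⟩
  have hj' : j < P.length := Finset.mem_range.mp hj
  have hs := List.getElem?_eq_getElem hj'
  have hk := hnn j
  have hsuc := height_succ (m := m) hs
  rw [h0] at hsuc
  rcases hcase : P[j] with _ | _ | _ <;> rw [hcase] at hs hsuc <;> simp only [stepVec] at hsuc
  · omega
  · exact hs
  · exact absurd (by omega) (hsmall j hs)

theorem mem_schroeder_iff {M t a b d : ℕ} {n : ℤ} (hn : n = t + 1 + a + b + d) {P : List Step} :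
    (IsSchroeder (M + 1) n (t + 1) P ∧ IsSmall (M + 1) P ∧ (ret (M + 1) P : ℤ) = b ∧
      (dg P : ℤ) = d) ↔
    ∃ w, Excursion M ((M + 1) * (t + 1)) b a d w ∧ List.replicate (t + 1) Step.N ++ w = P := by
  have hsn : StartsNorth (t + 1) P ↔ ∃ w, List.replicate (t + 1) Step.N ++ w = P := Iff.rfl
  rw [IsSchroeder, hsn]
  have main : ∀ w, P = List.replicate (t + 1) Step.N ++ w →
      ((pt P P.length = ((M + 1) * n, n) ∧ AboveLine (M + 1) P) ∧ IsSmall (M + 1) P ∧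
        (ret (M + 1) P : ℤ) = b ∧ (dg P : ℤ) = d ↔ Excursion M ((M + 1) * (t + 1)) b a d w) := by
    intro w hw
    have hP0 : P[0]? = some Step.N := by simp [hw, List.replicate_succ]
    rw [← Excursion.zero_replicate_append_iff, ← hw, excursion_iff]
    simp only [Nat.cast_zero, zero_add]
    have h1 : AboveLine (M + 1) P ↔ ∀ k, 0 ≤ height (M + 1) P k := by
      simp only [AboveLine, height, sub_nonneg]
    have h2 : IsSmall (M + 1) P ↔ ∀ j, P[j]? = some Step.D → height (M + 1) P j ≠ 0 := by
      exact forall₂_congr fun j _ => by rw [height, sub_ne_zero, ne_comm]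
    have h3 : pt P P.length = (((M : ℤ) + 1) * n, n) ↔
        height (M + 1) P P.length = 0 ∧ (pt P P.length).2 = n := by
      rw [height, Prod.ext_iff]
      constructor
      · rintro ⟨hx, hy⟩
        exact ⟨by rw [hx, hy]; ring, hy⟩
      · rintro ⟨hx, hy⟩
        rw [hy] at hx
        exact ⟨by linarith, hy⟩
    rw [h1, h2, h3]
    constructor
    · rintro ⟨⟨⟨hx, hy⟩, hnn⟩, hs, hr, hd⟩
      have := ret_add_one_eq_groundNorths (by positivity) hP0 hnn hs
      refine ⟨hnn, hx, hs, by omega, by omega, ?_⟩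
      push_cast
      rw [hy, hn]; ring
    · rintro ⟨hnn, hx, hs, hr, hd, hy⟩
      have := ret_add_one_eq_groundNorths (by positivity) hP0 hnn hs
      refine ⟨⟨⟨hx, ?_⟩, hnn⟩, hs, by omega, by omega⟩
      rw [hy, hn]; push_cast; ring
  constructor
  · rintro ⟨⟨⟨w, hw⟩, h1⟩, h2⟩
    exact ⟨w, (main w hw.symm).1 ⟨h1, h2⟩, hw⟩
  · rintro ⟨w, he, hw⟩
    obtain ⟨h1, h2⟩ := (main w hw.symm).2 he
    exact ⟨⟨⟨w, hw⟩, h1⟩, h2⟩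

theorem C_natCast (p q : ℕ) : C p q = p.choose q := by
  simp [C]

open Nat in
theorem mul_eq_choose_mul_choose {m r s a d c : ℕ} (hm : 0 < m) (hr : 0 < r)
    (hs : m * (r + a + d) = s + d)
    (hc : c * (a ! * d ! * s !) = m * r * (s + d + a - 1)!) :
    (r + a + d) * c = r * (s + d + a - 1).choose a * (s + d).choose d := by
  obtain ⟨u, hu⟩ : ∃ u, s + d = u + 1 := ⟨s + d - 1, by
    have : 0 < m * (r + a + d) := by positivity
    omega⟩
  have h1 : (s + d + a - 1).choose a * a ! * u ! = (s + d + a - 1)! := by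
    have := Nat.add_choose_mul_factorial_mul_factorial u a
    rw [show s + d + a - 1 = u + a by omega]
    linarith
  have h2 : (s + d).choose d * s ! * d ! = (u + 1) * u ! := by
    have := Nat.add_choose_mul_factorial_mul_factorial s d
    rw [hu, Nat.factorial_succ] at this
    rw [hu]
    exact this
  have hpos : 0 < m * (a ! * d ! * s !) * u ! := by positivity
  apply Nat.eq_of_mul_eq_mul_right hpos
  rw [← h1] at hc
  rw [hu] at hs
  generalize (s + d + a - 1).choose a = A at *
  generalize (s + d).choose d = B at *
  calc (r + a + d) * c * (m * (a ! * d ! * s !) * u !)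
      = (m * (r + a + d)) * (c * (a ! * d ! * s !)) * u ! := by ring
    _ = m * r * (A * a ! * u !) * ((u + 1) * u !) := by rw [hs, hc]; ring
    _ = m * r * (A * a ! * u !) * (B * s ! * d !) := by rw [h2]
    _ = _ := by ring

/-- the number of small `(m,t)`-Schröder paths of height `n` with `b` returns
and `n−t−a−b` diagonal steps. -/
theorem statement4 (m n t a b : ℤ) (hm : 0 < m) (hn : 0 < n) (ht : 0 < t)
    (ha : 0 ≤ a) (hb : 0 ≤ b) (hab : a + b ≤ n - t) :
    n * (({S : List Step | IsSchroeder m n t S ∧ IsSmall m S ∧ (ret m S : ℤ) = b ∧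
        (dg S : ℤ) = n - t - a - b}.ncard : ℤ))
      = (t + b) * C (m * n + a - 1) a * C (m * n) (n - t - a - b) := by
  obtain ⟨M, rfl⟩ : ∃ M : ℕ, m = M + 1 := ⟨(m - 1).toNat, by omega⟩
  obtain ⟨t, rfl⟩ : ∃ t' : ℕ, t = t' + 1 := ⟨(t - 1).toNat, by omega⟩
  lift a to ℕ using ha
  lift b to ℕ using hb
  obtain ⟨d, hd⟩ : ∃ d : ℕ, n - (t + 1) - a - b = d := ⟨(n - (t + 1) - a - b).toNat, by omega⟩
  have hn' : n = ((t + 1 + b + a + d : ℕ) : ℤ) := by push_cast; omega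
  obtain ⟨s, hs, -, hcard⟩ :=
    Excursion.exists_finset_card M _ ((M + 1) * (t + 1)) b a d rfl
  have hset : {S : List Step | IsSchroeder (M + 1) n (t + 1) S ∧ IsSmall (M + 1) S ∧
      (ret (M + 1) S : ℤ) = b ∧ (dg S : ℤ) = n - (t + 1) - a - b} =
      ((s.image (List.replicate (t + 1) Step.N ++ ·) : Finset (List Step)) : Set _) := by
    ext P
    simp only [Set.mem_ofPred_eq, Finset.coe_image, Set.mem_image, Finset.mem_coe, hs, hd]
    exact mem_schroeder_iff (by rw [hn']; push_cast; ring)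
  rw [hset, Set.ncard_coe_finset, Finset.card_image_of_injective _ (List.append_right_injective _),
    hd]
  set e := (M + 1) * (t + 1) + (M + 1) * b + (M + 1) * a + M * d with he
  have hcard' := hcard (fun h0 => absurd h0.1 (by positivity))
  rw [show (M + 1) * (t + 1) + (M + 1) * b + (M + 2) * a + (M + 1) * d - 1 = e + d + a - 1 by
    rw [he]; ring_nf, ← mul_add] at hcard'
  have hed : (M + 1) * (t + 1 + b + a + d) = e + d := by rw [he]; ring
  have key := mul_eq_choose_mul_choose (Nat.succ_pos M) (by omega) hed hcard'
  have hmn : ((M : ℤ) + 1) * n = ((e + d : ℕ) : ℤ) := by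
    rw [← hed, hn']; push_cast; ring
  have hpos : 0 < e + d := by rw [← hed]; positivity
  rw [hmn, show ((e + d : ℕ) : ℤ) + a - 1 = ((e + d + a - 1 : ℕ) : ℤ) by omega, C_natCast,
    C_natCast, hn']
  exact_mod_cast key
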